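/- arXiv:2412.03350 — 2 statements merged into one kernel-verified Lean document; each statement's English description precedes it below -/
import Mathlib

section
/- For every κ with 0 < κ < 1 there exists a constant C_κ > 0 such that for every integer n ≥ 3: Υ_κ(n) ≤ exp( C_κ · (log n)^{1−κ} / log log n ). -/
open scoped BigOperators
open Finset

noncomputable section

/-- `Υ_κ(n) = ∏_{p ∣ n} (1 − p^{−κ})⁻¹` for a positive integer `n`. -/
def UpsilonN (κ : ℝ) (n : ℕ) : ℝ :=
  ∏ p ∈ n.primeFactors, (1 - (p : ℝ) ^ (-κ))⁻¹

/-- The weighted prime sum. -/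
def FF (κ x : ℝ) : ℝ := ∑ p ∈ Ioc 0 ⌊x⌋₊ with p.Prime, Real.log p * (p : ℝ) ^ (-κ)

lemma FF_step (κ : ℝ) (hκ0 : 0 < κ) (x : ℝ) (hx : 0 < x) :
    FF κ x ≤ FF κ (x / 2) + (2 ^ κ * Real.log 4) * x ^ (1 - κ) := by
  have hsub : ((Ioc 0 ⌊x⌋₊).filter Nat.Prime) ⊆
      (Ioc 0 ⌊x / 2⌋₊).filter Nat.Prime ∪
        ((Ioc 0 ⌊x⌋₊).filter Nat.Prime).filter (fun p => x / 2 < (p : ℝ)) := by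
    intro p hp
    simp only [mem_union, mem_filter, mem_Ioc] at hp ⊢
    by_cases h : x / 2 < (p : ℝ)
    · exact Or.inr ⟨hp, h⟩
    · exact Or.inl ⟨⟨hp.1.1, Nat.le_floor (not_lt.mp h)⟩, hp.2⟩
  have hnn : ∀ p : ℕ, 0 ≤ Real.log p * (p : ℝ) ^ (-κ) := fun p =>
    mul_nonneg (Real.log_natCast_nonneg p) (Real.rpow_nonneg (Nat.cast_nonneg p) _)
  have h1 : FF κ x ≤ FF κ (x / 2) +
      ∑ p ∈ ((Ioc 0 ⌊x⌋₊).filter Nat.Prime).filter (fun p : ℕ => x / 2 < (p : ℝ)),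
        Real.log p * (p : ℝ) ^ (-κ) := by
    unfold FF
    refine (sum_le_sum_of_subset_of_nonneg hsub (fun i _ _ => hnn i)).trans ?_
    rw [← sum_union_inter]
    exact le_add_of_nonneg_right (sum_nonneg fun i _ => hnn i)
  have h2 : ∑ p ∈ ((Ioc 0 ⌊x⌋₊).filter Nat.Prime).filter (fun p : ℕ => x / 2 < (p : ℝ)),
        Real.log p * (p : ℝ) ^ (-κ) ≤ Chebyshev.theta x * (x / 2) ^ (-κ) := by
    unfold Chebyshev.theta
    rw [sum_mul]
    refine le_trans (sum_le_sum (g := fun p : ℕ => Real.log p * (x / 2) ^ (-κ)) ?_)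
      (sum_le_sum_of_subset_of_nonneg (filter_subset _ _) ?_)
    · intro p hp
      rw [mem_filter] at hp
      exact mul_le_mul_of_nonneg_left
        (Real.rpow_le_rpow_of_nonpos (by positivity) hp.2.le (by linarith))
        (Real.log_natCast_nonneg p)
    · intro p _ _
      exact mul_nonneg (Real.log_natCast_nonneg p) (by positivity)
  have h3 : Chebyshev.theta x * (x / 2) ^ (-κ) ≤ (2 ^ κ * Real.log 4) * x ^ (1 - κ) := by
    have : (2 ^ κ * Real.log 4) * x ^ (1 - κ) = (Real.log 4 * x) * (x / 2) ^ (-κ) := by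
      rw [Real.div_rpow hx.le (by norm_num), Real.rpow_neg (by norm_num : (0:ℝ) ≤ 2),
        sub_eq_add_neg, Real.rpow_add hx, Real.rpow_one]
      field_simp
    rw [this]
    exact mul_le_mul_of_nonneg_right (Chebyshev.theta_le_log4_mul_x hx.le) (by positivity)
  linarith

lemma FF_bound (κ : ℝ) (hκ0 : 0 < κ) (hκ1 : κ < 1) :
    ∃ B : ℝ, 0 < B ∧ ∀ x : ℝ, 0 < x → FF κ x ≤ B * x ^ (1 - κ) := by
  have hr : (2 : ℝ) ^ (-(1 - κ)) < 1 :=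
    Real.rpow_lt_one_of_one_lt_of_neg (by norm_num) (by linarith)
  have hd : 0 < 1 - (2 : ℝ) ^ (-(1 - κ)) := by linarith
  have hl : 0 < Real.log 4 := Real.log_pos (by norm_num)
  set D := (2 : ℝ) ^ κ * Real.log 4 with hD
  have hDp : 0 < D := by positivity
  refine ⟨D / (1 - (2 : ℝ) ^ (-(1 - κ))), by positivity, ?_⟩
  set B := D / (1 - (2 : ℝ) ^ (-(1 - κ))) with hB
  have hBp : 0 < B := by positivity
  have hBD : B * (2 : ℝ) ^ (-(1 - κ)) + D = B := by
    rw [hB]; field_simp; ring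
  have key : ∀ N : ℕ, ∀ x : ℝ, 0 < x → x < 2 ^ N → FF κ x ≤ B * x ^ (1 - κ) := by
    intro N
    induction N with
    | zero =>
      intro x hx hx1
      have : ⌊x⌋₊ = 0 := Nat.floor_eq_zero.mpr (by simpa using hx1)
      unfold FF
      rw [this]
      simp only [Ioc_self, filter_empty, sum_empty]
      positivity
    | succ N ih =>
      intro x hx hx1
      have h1 := ih (x / 2) (by positivity) (by rw [pow_succ] at hx1; linarith)
      have h2 := FF_step κ hκ0 x hx
      have h3 : (x / 2) ^ (1 - κ) = x ^ (1 - κ) * (2 : ℝ) ^ (-(1 - κ)) := by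
        rw [Real.div_rpow hx.le (by norm_num), Real.rpow_neg (by norm_num : (0:ℝ) ≤ 2)]
        rfl
      rw [h3] at h1
      rw [← hD] at h2
      calc FF κ x ≤ (B * (2 : ℝ) ^ (-(1 - κ)) + D) * x ^ (1 - κ) := by linarith
        _ = _ := by rw [hBD]
  intro x hx
  obtain ⟨N, hN⟩ := pow_unbounded_of_one_lt x (by norm_num : (1:ℝ) < 2)
  exact key N x hx hN

lemma small_prime_sum (κ : ℝ) (hκ0 : 0 < κ) (hκ1 : κ < 1) :
    ∃ C : ℝ, 0 < C ∧ ∀ L : ℝ, 1 < L →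
      ∑ p ∈ Ioc 0 ⌊L⌋₊ with p.Prime, (p : ℝ) ^ (-κ) ≤ C * (L ^ (1 - κ) / Real.log L) := by
  obtain ⟨B, hB, hF⟩ := FF_bound κ hκ0 hκ1
  have hl2 : 0 < Real.log 2 := Real.log_pos (by norm_num)
  have he : 0 < (1 - κ) / 2 := by linarith
  refine ⟨B / Real.log 2 / ((1 - κ) / 2) + 2 * B, by positivity, fun L hL => ?_⟩
  have hL0 : 0 < L := by linarith
  have hlL : 0 < Real.log L := Real.log_pos hL
  have hnn : ∀ p : ℕ, 0 ≤ Real.log p * (p : ℝ) ^ (-κ) := fun p =>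
    mul_nonneg (Real.log_natCast_nonneg p) (Real.rpow_nonneg (Nat.cast_nonneg p) _)
  have h1 : ∑ p ∈ ((Ioc 0 ⌊L⌋₊).filter Nat.Prime).filter (fun p : ℕ => (p : ℝ) ≤ √L),
      (p : ℝ) ^ (-κ) ≤ FF κ √L / Real.log 2 := by
    unfold FF
    rw [sum_div]
    refine le_trans (sum_le_sum (g := fun p : ℕ => Real.log p * (p : ℝ) ^ (-κ) / Real.log 2) ?_)
      (sum_le_sum_of_subset_of_nonneg ?_ ?_)
    · intro p hp
      simp only [mem_filter] at hp
      rw [le_div_iff₀ hl2, mul_comm]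
      refine mul_le_mul_of_nonneg_right (Real.log_le_log (by norm_num) ?_) (by positivity)
      exact_mod_cast hp.1.2.two_le
    · intro p hp
      simp only [mem_filter, mem_Ioc] at hp ⊢
      exact ⟨⟨hp.1.1.1, Nat.le_floor hp.2⟩, hp.1.2⟩
    · intro p _ _
      exact div_nonneg (hnn p) hl2.le
  have h2 : ∑ p ∈ ((Ioc 0 ⌊L⌋₊).filter Nat.Prime).filter (fun p : ℕ => ¬ (p : ℝ) ≤ √L),
      (p : ℝ) ^ (-κ) ≤ FF κ L / (Real.log L / 2) := by
    unfold FF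
    rw [sum_div]
    refine le_trans (sum_le_sum
      (g := fun p : ℕ => Real.log p * (p : ℝ) ^ (-κ) / (Real.log L / 2)) ?_)
      (sum_le_sum_of_subset_of_nonneg (filter_subset _ _) ?_)
    · intro p hp
      simp only [mem_filter, not_le] at hp
      rw [le_div_iff₀ (by positivity), mul_comm]
      refine mul_le_mul_of_nonneg_right ?_ (by positivity)
      rw [← Real.log_sqrt hL0.le]
      exact Real.log_le_log (Real.sqrt_pos.mpr hL0) hp.2.le
    · intro p _ _
      exact div_nonneg (hnn p) (by positivity)
  rw [← sum_filter_add_sum_filter_not _ (fun p : ℕ => (p : ℝ) ≤ √L)]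
  have h3 := hF (√L) (Real.sqrt_pos.mpr hL0)
  have h4 := hF L hL0
  have h5 : (√L) ^ (1 - κ) = L ^ ((1 - κ) / 2) := by
    rw [Real.sqrt_eq_rpow, ← Real.rpow_mul hL0.le]; congr 1; ring
  have h6 : L ^ ((1 - κ) / 2) ≤ L ^ (1 - κ) / Real.log L / ((1 - κ) / 2) := by
    have h7 := Real.log_le_rpow_div hL0.le he
    rw [le_div_iff₀ he] at h7
    rw [le_div_iff₀ he, le_div_iff₀ hlL]
    have h8 : L ^ (1 - κ) = L ^ ((1 - κ) / 2) * L ^ ((1 - κ) / 2) := by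
      rw [← Real.rpow_add hL0]; congr 1; ring
    rw [h8, mul_assoc]
    refine mul_le_mul_of_nonneg_left ?_ (by positivity)
    linarith
  rw [h5] at h3
  have h9 : FF κ √L / Real.log 2 ≤
      B / Real.log 2 / ((1 - κ) / 2) * (L ^ (1 - κ) / Real.log L) := by
    calc FF κ √L / Real.log 2
        ≤ (B * (L ^ (1 - κ) / Real.log L / ((1 - κ) / 2))) / Real.log 2 := by
          refine div_le_div_of_nonneg_right (h3.trans ?_) hl2.le
          exact mul_le_mul_of_nonneg_left h6 hB.le
      _ = _ := by ring
  have h10 : FF κ L / (Real.log L / 2) ≤ 2 * B * (L ^ (1 - κ) / Real.log L) := by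
    calc FF κ L / (Real.log L / 2) ≤ (B * L ^ (1 - κ)) / (Real.log L / 2) :=
          div_le_div_of_nonneg_right h4 (by positivity)
      _ = _ := by field_simp
  rw [add_mul]
  linarith

lemma large_sum (κ : ℝ) (hκ0 : 0 < κ) (n : ℕ) (hn : 3 ≤ n) (hL : 1 < Real.log n) :
    ∑ p ∈ n.primeFactors with ¬ ((p : ℕ) : ℝ) ≤ Real.log n, (p : ℝ) ^ (-κ)
      ≤ Real.log n ^ (1 - κ) / Real.log (Real.log n) := by
  set L := Real.log n with hLdef
  have hL0 : 0 < L := by linarith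
  have hlL : 0 < Real.log L := Real.log_pos hL
  have hle : ∑ p ∈ n.primeFactors, Real.log p ≤ L := by
    rw [← Real.log_prod]
    · rw [hLdef]
      have h := Nat.le_of_dvd (by omega) (Nat.prod_primeFactors_dvd n)
      have hpos : 0 < ∏ p ∈ n.primeFactors, p :=
        prod_pos fun p hp => (Nat.prime_of_mem_primeFactors hp).pos
      rw [← Nat.cast_prod]
      exact Real.log_le_log (by exact_mod_cast hpos) (by exact_mod_cast h)
    · intro p hp
      exact_mod_cast (Nat.prime_of_mem_primeFactors hp).ne_zero
  have h1 : ∑ p ∈ n.primeFactors with ¬ ((p : ℕ) : ℝ) ≤ L, (p : ℝ) ^ (-κ) ≤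
      ∑ p ∈ n.primeFactors, Real.log p * (L ^ (-κ) / Real.log L) := by
    refine le_trans (sum_le_sum
      (g := fun p : ℕ => Real.log p * (L ^ (-κ) / Real.log L)) ?_)
      (sum_le_sum_of_subset_of_nonneg (filter_subset _ _) ?_)
    · intro p hp
      simp only [mem_filter, not_le] at hp
      have a := Real.rpow_le_rpow_of_nonpos hL0 hp.2.le (by linarith : -κ ≤ 0)
      have b : Real.log L ≤ Real.log p := Real.log_le_log hL0 hp.2.le
      refine a.trans ?_
      rw [← mul_div_assoc, le_div_iff₀ hlL, mul_comm]
      exact mul_le_mul_of_nonneg_right b (by positivity)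
    · intro p _ _
      exact mul_nonneg (Real.log_natCast_nonneg p) (by positivity)
  refine h1.trans ?_
  rw [← sum_mul, sub_eq_add_neg, Real.rpow_add hL0, Real.rpow_one, mul_div_assoc]
  exact mul_le_mul_of_nonneg_right hle (by positivity)

theorem stmt13 (κ : ℝ) (hκ0 : 0 < κ) (hκ1 : κ < 1) :
    ∃ C : ℝ, 0 < C ∧
      ∀ n : ℕ, 3 ≤ n →
        UpsilonN κ n
          ≤ Real.exp (C * Real.log n ^ ((1 : ℝ) - κ) / Real.log (Real.log n)) := by
  obtain ⟨C, hC, hS⟩ := small_prime_sum κ hκ0 hκ1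
  have hr : (2 : ℝ) ^ (-κ) < 1 :=
    Real.rpow_lt_one_of_one_lt_of_neg (by norm_num) (by linarith)
  have hd : 0 < 1 - (2 : ℝ) ^ (-κ) := by linarith
  set A := (1 - (2 : ℝ) ^ (-κ))⁻¹ with hA
  have hAp : 0 < A := inv_pos.mpr hd
  refine ⟨A * (C + 1), by positivity, fun n hn => ?_⟩
  have hL : 1 < Real.log n := by
    rw [Real.lt_log_iff_exp_lt (by positivity)]
    have : (3 : ℝ) ≤ n := by exact_mod_cast hn
    linarith [Real.exp_one_lt_d9]
  have hsum : ∑ p ∈ n.primeFactors, (p : ℝ) ^ (-κ) ≤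
      (C + 1) * (Real.log n ^ (1 - κ) / Real.log (Real.log n)) := by
    rw [← sum_filter_add_sum_filter_not _ (fun p : ℕ => (p : ℝ) ≤ Real.log n), add_mul, one_mul]
    refine add_le_add (le_trans (sum_le_sum_of_subset_of_nonneg ?_ ?_) (hS _ hL))
      (large_sum κ hκ0 n hn hL)
    · intro p hp
      simp only [mem_filter, mem_Ioc] at hp ⊢
      have := Nat.prime_of_mem_primeFactors hp.1
      exact ⟨⟨this.pos, Nat.le_floor hp.2⟩, this⟩
    · intro p _ _
      positivity
  have hprod : UpsilonN κ n ≤ ∏ p ∈ n.primeFactors, Real.exp (A * (p : ℝ) ^ (-κ)) := by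
    have hp2 : ∀ p ∈ n.primeFactors, (p : ℝ) ^ (-κ) ≤ (2 : ℝ) ^ (-κ) := fun p hp =>
      Real.rpow_le_rpow_of_nonpos (by norm_num)
        (by exact_mod_cast (Nat.prime_of_mem_primeFactors hp).two_le) (by linarith)
    unfold UpsilonN
    refine prod_le_prod (fun p hp => ?_) (fun p hp => ?_)
    · have := hp2 p hp
      exact inv_nonneg.mpr (by linarith)
    · have h := hp2 p hp
      have h0 : 0 ≤ (p : ℝ) ^ (-κ) := by positivity
      set t := (p : ℝ) ^ (-κ)
      have ht : 0 < 1 - t := by linarith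
      have hi : (1 - t)⁻¹ ≤ A := inv_anti₀ hd (by linarith)
      have e : (1 - t)⁻¹ = 1 + (1 - t)⁻¹ * t := by field_simp; ring
      have := Real.add_one_le_exp (A * t)
      have := mul_le_mul_of_nonneg_right hi h0
      linarith
  refine hprod.trans ?_
  rw [← Real.exp_sum, ← mul_sum]
  refine Real.exp_le_exp.mpr ?_
  rw [mul_div_assoc, mul_assoc]
  exact mul_le_mul_of_nonneg_left hsum hAp.le
end
end

section
/- For every positive integer q: ∑_{u ∈ ℤ/q with u² = 0 in ℤ/q} e_q(u) = μ(q)², where μ is the Möbius function. -/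
open scoped BigOperators
open Finset

noncomputable section

def eN (n : ℕ) (x : ℤ) : ℂ := Complex.exp (2 * Real.pi * Complex.I * x / n)

theorem eN_eq_std (q : ℕ) [NeZero q] (u : ZMod q) :
    eN q ((u.val : ℤ)) = ZMod.stdAddChar u := by
  have h := ZMod.stdAddChar_coe (N := q) (u.val : ℤ)
  rw [show (((u.val : ℤ)) : ZMod q) = u by simp] at h
  rw [h]
  rfl

theorem stmt18 (q : ℕ) [NeZero q] :
    (∑ u : ZMod q, if u ^ 2 = 0 then eN q ((u.val : ℤ)) else 0)
      = (((ArithmeticFunction.moebius q) ^ 2 : ℤ) : ℂ) := by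
  classical
  simp only [eN_eq_std]
  by_cases hq : Squarefree q
  · rw [ArithmeticFunction.moebius_sq_eq_one_of_squarefree hq]
    have key : ∀ u : ZMod q, u ^ 2 = 0 ↔ u = 0 := by
      intro u
      constructor
      · intro h
        rw [← ZMod.natCast_zmod_val u] at h ⊢
        rw [← Nat.cast_pow, ZMod.natCast_eq_zero_iff] at h
        rw [ZMod.natCast_eq_zero_iff]
        exact (hq.dvd_pow_iff_dvd two_ne_zero).1 h
      · rintro rfl
        simp
    simp [key]
  · rw [ArithmeticFunction.moebius_eq_zero_of_not_squarefree hq]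
    have hq0 : q ≠ 0 := NeZero.ne q
    rw [Nat.squarefree_iff_prime_squarefree] at hq
    push Not at hq
    obtain ⟨p, hp, m, hm⟩ := hq
    have hm0 : 0 < m := by
      rcases Nat.eq_zero_or_pos m with h | h
      · subst h; simp at hm; exact absurd hm hq0
      · exact h
    set v : ZMod q := ((p * m : ℕ) : ZMod q) with hv
    have hv0 : v ≠ 0 := by
      intro h
      rw [hv, ZMod.natCast_eq_zero_iff] at h
      have h1 := Nat.le_of_dvd (Nat.mul_pos hp.pos hm0) h
      have h2 : p * m * 2 ≤ p * m * p := Nat.mul_le_mul_left _ hp.two_le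
      have h3 : 0 < p * m := Nat.mul_pos hp.pos hm0
      have h4 : q = p * m * p := by rw [hm]; ring
      omega
    have hvv : v * v = 0 := by
      rw [hv, ← Nat.cast_mul, ZMod.natCast_eq_zero_iff]
      exact ⟨m, by calc p * m * (p * m) = (p * p * m) * m := by ring
                  _ = q * m := by rw [← hm]⟩
    have huv : ∀ u : ZMod q, u ^ 2 = 0 → u * v = 0 := by
      intro u h
      rw [← ZMod.natCast_zmod_val u] at h ⊢
      rw [← Nat.cast_pow, ZMod.natCast_eq_zero_iff] at h
      have hpq : p ∣ q := ⟨p * m, by rw [← mul_assoc]; exact hm⟩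
      obtain ⟨k, hk⟩ := hp.dvd_of_dvd_pow (hpq.trans h)
      rw [hv, ← Nat.cast_mul, ZMod.natCast_eq_zero_iff]
      refine ⟨k, ?_⟩
      rw [hk]
      calc p * k * (p * m) = (p * p * m) * k := by ring
        _ = q * k := by rw [← hm]
    have hiff : ∀ u : ZMod q, (u + v) ^ 2 = 0 ↔ u ^ 2 = 0 := by
      intro u
      constructor
      · intro h
        have h1 := huv _ h
        linear_combination h - 2 * h1 + hvv
      · intro h
        linear_combination h + 2 * huv u h + hvv
    set S := ∑ u : ZMod q, if u ^ 2 = 0 then (ZMod.stdAddChar u : ℂ) else 0 with hS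
    have hSv : S = S * ZMod.stdAddChar v := by
      conv_lhs => rw [hS, ← Equiv.sum_comp (Equiv.addRight v)]
      rw [hS, Finset.sum_mul]
      refine Finset.sum_congr rfl fun u _ => ?_
      simp only [Equiv.coe_addRight, hiff, AddChar.map_add_eq_mul, ite_mul, zero_mul]
    have hne : (ZMod.stdAddChar v : ℂ) ≠ 1 := by
      intro h
      apply hv0
      apply ZMod.injective_stdAddChar
      rw [h, AddChar.map_zero_eq_one]
    have h0 : S * (ZMod.stdAddChar v - 1) = 0 := by linear_combination -hSv
    rcases mul_eq_zero.1 h0 with h | h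
    · simpa using h
    · exact absurd (sub_eq_zero.1 h) hne
end
end
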